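/- Let g, d be positive integers and s ∈ [0,1]^g. The following are equivalent: (i) s ∈ Γ(g,d), i.e., for all d×d effects E_1,…,E_g the noisy effects s_i E_i + (1−s_i) I/2 are compatible; (ii) for every g-tuple (X_1,…,X_g) of d×d Hermitian matrices satisfying ∑_{i=1}^g ε_i X_i ≤ I for all sign vectors ε ∈ {−1,1}^g, there exist positive semidefinite matrices P_1,…,P_g, N_1,…,N_g with s_i X_i = P_i − N_i for all i and ∑_{i=1}^g (P_i + N_i) ≤ I. In other words, Γ(g,d) equals the matrix diamond inclusion set Δ_◇(g,d). -/

import Mathlib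

open Matrix ComplexOrder

noncomputable section

/-- A quantum effect: `0 ≤ E ≤ I` in the Loewner order. -/
def IsEffect {d : ℕ} (E : Matrix (Fin d) (Fin d) ℂ) : Prop :=
  E.PosSemidef ∧ ((1 : Matrix (Fin d) (Fin d) ℂ) - E).PosSemidef

/-- Effects `E i` are compatible if the dichotomic POVMs `(E i, I - E i)` are jointly measurable:
there is a joint POVM `(K ε)` indexed by sign vectors with `E i = ∑_{ε : ε i = 1} K ε`. -/
def CompatibleEffects {g d : ℕ} (E : Fin g → Matrix (Fin d) (Fin d) ℂ) : Prop :=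
  ∃ K : (Fin g → Bool) → Matrix (Fin d) (Fin d) ℂ,
    (∀ ε, (K ε).PosSemidef) ∧ (∑ ε, K ε = 1) ∧
    ∀ i, E i = ∑ ε ∈ Finset.univ.filter (fun ε : Fin g → Bool => ε i = true), K ε

/-- The compatibility region `Γ(g, d)` for dichotomic measurements. -/
def GammaD (g d : ℕ) : Set (Fin g → ℝ) :=
  {s | (∀ i, s i ∈ Set.Icc (0 : ℝ) 1) ∧
    ∀ E : Fin g → Matrix (Fin d) (Fin d) ℂ, (∀ i, IsEffect (E i)) →
      CompatibleEffects (fun i => s i • E i +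
        ((1 - s i) * (2 : ℝ)⁻¹) • (1 : Matrix (Fin d) (Fin d) ℂ))}

section MatrixDuality

variable {n : Type*} [Fintype n]

lemma Matrix.PosSemidef.trace_mul_re_nonneg [DecidableEq n] {A B : Matrix n n ℂ}
    (hA : A.PosSemidef) (hB : B.PosSemidef) : 0 ≤ (A * B).trace.re := by
  open scoped MatrixOrder in
  obtain ⟨C, rfl⟩ := CStarAlgebra.nonneg_iff_eq_star_mul_self.mp hB.nonneg
  rw [star_eq_conjTranspose, ← mul_assoc, Matrix.trace_mul_comm, ← mul_assoc]
  exact (Complex.nonneg_iff.mp (hA.mul_mul_conjTranspose_same C).trace_nonneg).1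

/-- Every real-linear functional is represented on Hermitian matrices by a Hermitian matrix. -/
lemma exists_isHermitian_trace_eq [DecidableEq n] (φ : Matrix n n ℂ →ₗ[ℝ] ℝ) :
    ∃ Y : Matrix n n ℂ, Y.IsHermitian ∧
      ∀ M : Matrix n n ℂ, M.IsHermitian → (Y * M).trace.re = φ M := by
  set Z : Matrix n n ℂ := fun b a =>
    ⟨φ (Matrix.single a b 1), -φ (Matrix.single a b Complex.I)⟩ with hZ
  have hZM (M : Matrix n n ℂ) : (Z * M).trace.re = φ M := by
    have hM : φ M = ∑ a, ∑ b, φ (Matrix.single a b (M a b)) := by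
      conv_lhs => rw [Matrix.matrix_eq_sum_single M]
      simp only [map_sum]
    have hentry (a b : n) : φ (Matrix.single a b (M a b)) = (Z b a * M a b).re := by
      have : Matrix.single a b (M a b) =
          (M a b).re • Matrix.single a b (1 : ℂ) + (M a b).im • Matrix.single a b Complex.I := by
        rw [Matrix.smul_single, Matrix.smul_single, ← Matrix.single_add]
        congr 1
        simp [Complex.re_add_im]
      rw [this, map_add, map_smul, map_smul]
      simp [hZ, Complex.mul_re]
      ring
    simp only [hM, hentry, Matrix.trace, Matrix.diag, Matrix.mul_apply, Complex.re_sum]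
    exact Finset.sum_comm
  refine ⟨(2 : ℝ)⁻¹ • (Z + Zᴴ), ?_, fun M hM => ?_⟩
  · simp [Matrix.IsHermitian, Matrix.conjTranspose_smul, add_comm]
  · have h : (Zᴴ * M).trace.re = (Z * M).trace.re := by
      have : Zᴴ * M = (M * Z)ᴴ := by rw [Matrix.conjTranspose_mul, hM.eq]
      rw [this, Matrix.trace_conjTranspose, Matrix.trace_mul_comm M Z]
      simp
    rw [smul_mul_assoc, add_mul, Matrix.trace_smul, Matrix.trace_add, Complex.smul_re,
      Complex.add_re, h, hZM, smul_eq_mul]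
    ring

lemma isCompact_posSemidef_trace_sum_eq_one [DecidableEq n] (J : Type*) [Fintype J] :
    IsCompact {K : J → Matrix n n ℂ |
      (∀ j, (K j).PosSemidef) ∧ ∑ j, (K j).trace.re = 1} := by
  have htr (C : Matrix n n ℂ) : (Cᴴ * C).trace.re = ∑ a, ∑ b, ‖C b a‖ ^ 2 := by
    simp only [Matrix.trace, Matrix.diag, Matrix.mul_apply, Complex.re_sum,
      Matrix.conjTranspose_apply]
    refine Finset.sum_congr rfl fun a _ => Finset.sum_congr rfl fun b _ => ?_
    rw [Complex.star_def, ← Complex.normSq_eq_conj_mul_self, Complex.ofReal_re,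
      Complex.normSq_eq_norm_sq]
  set S : Set (J → Matrix n n ℂ) := {C | ∑ j, ∑ a, ∑ b, ‖C j b a‖ ^ 2 = 1}
  have hcompact : IsCompact S := by
    refine IsCompact.of_isClosed_subset
      (isCompact_univ_pi fun _ : J => isCompact_univ_pi fun _ : n => isCompact_univ_pi fun _ : n =>
        isCompact_closedBall (0 : ℂ) 1) ?_ ?_
    · exact isClosed_eq (by fun_prop) continuous_const
    · intro C hC j _ b _ a _
      have h1 : ‖C j b a‖ ^ 2 ≤ 1 := by
        rw [← (show ∑ j, ∑ a, ∑ b, ‖C j b a‖ ^ 2 = 1 from hC)]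
        calc ‖C j b a‖ ^ 2 ≤ ∑ b, ‖C j b a‖ ^ 2 :=
              Finset.single_le_sum (f := fun b => ‖C j b a‖ ^ 2)
                (fun _ _ => by positivity) (Finset.mem_univ b)
          _ ≤ ∑ a, ∑ b, ‖C j b a‖ ^ 2 :=
              Finset.single_le_sum (f := fun a => ∑ b, ‖C j b a‖ ^ 2)
                (fun _ _ => by positivity) (Finset.mem_univ a)
          _ ≤ _ := Finset.single_le_sum (f := fun j => ∑ a, ∑ b, ‖C j b a‖ ^ 2)
                (fun _ _ => by positivity) (Finset.mem_univ j)
      rw [mem_closedBall_zero_iff]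
      exact (sq_le_one_iff₀ (norm_nonneg _)).mp h1
  have hcont : Continuous fun (C : J → Matrix n n ℂ) (j : J) => (C j)ᴴ * C j := by fun_prop
  convert hcompact.image hcont using 1
  ext K
  constructor
  · rintro ⟨hK, htrace⟩
    have hfac (j : J) : ∃ C : Matrix n n ℂ, K j = Cᴴ * C := by
      open scoped MatrixOrder in
      exact CStarAlgebra.nonneg_iff_eq_star_mul_self.mp (hK j).nonneg
    choose C hC using hfac
    refine ⟨C, ?_, funext fun j => (hC j).symm⟩
    simp only [hC, htr] at htrace
    exact htrace
  · rintro ⟨C, hC, rfl⟩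
    refine ⟨fun j => Matrix.posSemidef_conjTranspose_mul_self _, ?_⟩
    simp only [htr]
    exact hC

lemma Matrix.IsHermitian.posDef_of_trace_mul_pos [DecidableEq n] {H : Matrix n n ℂ}
    (hH : H.IsHermitian)
    (h : ∀ k : Matrix n n ℂ, k.PosSemidef → k.trace.re = 1 → 0 < (H * k).trace.re) :
    H.PosDef := by
  refine .of_dotProduct_mulVec_pos hH fun v hv => ?_
  have hk := Matrix.posSemidef_vecMulVec_self_star v
  have htr : (vecMulVec v (star v)).trace = star v ⬝ᵥ v := by
    rw [Matrix.trace_vecMulVec, dotProduct_comm]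
  have hpos : 0 < (star v ⬝ᵥ v).re :=
    (Complex.pos_iff.mp (dotProduct_star_self_pos_iff.mpr hv)).1
  have h1 := h ((star v ⬝ᵥ v).re⁻¹ • vecMulVec v (star v)) (hk.smul (by positivity)) (by
    rw [Matrix.trace_smul, Complex.smul_re, htr, smul_eq_mul, inv_mul_cancel₀ hpos.ne'])
  rw [mul_smul_comm, Matrix.trace_smul, Complex.smul_re, smul_eq_mul, Matrix.mul_vecMulVec,
    Matrix.trace_vecMulVec, dotProduct_comm (H *ᵥ v)] at h1
  refine Complex.pos_iff.mpr ⟨(pos_iff_pos_of_mul_pos h1).mp (by positivity), ?_⟩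
  have hself : star (star v ⬝ᵥ (H *ᵥ v)) = star v ⬝ᵥ (H *ᵥ v) := by
    conv_rhs => rw [Matrix.star_dotProduct, star_mulVec, hH.eq, ← dotProduct_mulVec]
  exact (Complex.conj_eq_iff_im.mp hself).symm

/-- Theorem of alternatives for conic combinations with positive semidefinite coefficients. -/
lemma exists_dual_certificate [DecidableEq n] [Nonempty n] {J ι : Type*} [Fintype J] [Fintype ι]
    [DecidableEq ι] (a : J → ι → ℝ) (e : ι) (he : ∀ j, a j e = 1) (B : ι → Matrix n n ℂ)
    (hB : ∀ i, (B i).IsHermitian) (hBe : B e = 1)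
    (hno : ¬ ∃ K : J → Matrix n n ℂ, (∀ j, (K j).PosSemidef) ∧ ∀ i, B i = ∑ j, a j i • K j) :
    ∃ Y : ι → Matrix n n ℂ, (∀ i, (Y i).IsHermitian) ∧
      (∀ j, (∑ i, a j i • Y i).PosDef) ∧ ∑ i, (Y i * B i).trace.re < 0 := by
  classical
  have : LocallyConvexSpace ℝ (Matrix n n ℂ) :=
    inferInstanceAs (LocallyConvexSpace ℝ (n → n → ℂ))
  set N : ℝ := (Fintype.card n : ℝ) with hN
  have hNpos : 0 < N := by simp [hN, Fintype.card_pos]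
  set T : Set (J → Matrix n n ℂ) := {K : J → Matrix n n ℂ |
      (∀ j, (K j).PosSemidef) ∧ ∑ j, (K j).trace.re = 1}
  have hTconv : Convex ℝ T := by
    rintro K ⟨hK, hK1⟩ K' ⟨hK', hK1'⟩ x y hx hy hxy
    refine ⟨fun j => ((hK j).smul hx).add ((hK' j).smul hy), ?_⟩
    simp only [Pi.add_apply, Pi.smul_apply, Matrix.trace_add, Matrix.trace_smul, Complex.add_re,
      Complex.smul_re, Finset.sum_add_distrib, ← Finset.smul_sum, hK1, hK1']
    simpa using hxy
  set L : (J → Matrix n n ℂ) →ₗ[ℝ] (ι → Matrix n n ℂ) :=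
    LinearMap.pi fun i => ∑ j, a j i • LinearMap.proj j with hL
  have hLapp (K : J → Matrix n n ℂ) (i : ι) : L K i = ∑ j, a j i • K j := by
    simp [hL, LinearMap.sum_apply]
  have hLcont : Continuous L := by
    refine continuous_pi fun i => ?_
    simp only [hLapp]
    fun_prop
  have hnot : N⁻¹ • B ∉ L '' T := by
    rintro ⟨K, ⟨hK, -⟩, hKB⟩
    refine hno ⟨fun j => N • K j, fun j => (hK j).smul hNpos.le, fun i => ?_⟩
    have := congrFun hKB i
    rw [hLapp, Pi.smul_apply] at this
    simp only [smul_comm _ N, ← Finset.smul_sum]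
    rw [this, smul_inv_smul₀ hNpos.ne']
  obtain ⟨f, u, hfB, hfT⟩ := geometric_hahn_banach_point_closed (hTconv.linear_image L)
    ((isCompact_posSemidef_trace_sum_eq_one J).image hLcont).isClosed hnot
  have hrep (i : ι) := exists_isHermitian_trace_eq
    (f.toLinearMap ∘ₗ LinearMap.single ℝ (fun _ : ι => Matrix n n ℂ) i)
  choose Y hY hYf using hrep
  have hfsum (x : ι → Matrix n n ℂ) (hx : ∀ i, (x i).IsHermitian) :
      f x = ∑ i, (Y i * x i).trace.re := by
    conv_lhs => rw [← Finset.univ_sum_single x, map_sum]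
    exact Finset.sum_congr rfl fun i _ => (hYf i (x i) (hx i)).symm
  set W : ι → Matrix n n ℂ := fun i => Y i - Pi.single (M := fun _ => Matrix n n ℂ) e (u • 1) i
    with hW
  have hWsum (x : ι → Matrix n n ℂ) (hx : ∀ i, (x i).IsHermitian) :
      ∑ i, (W i * x i).trace.re = f x - u * (x e).trace.re := by
    rw [hfsum x hx]
    simp only [hW, sub_mul, Matrix.trace_sub, Complex.sub_re, Finset.sum_sub_distrib]
    congr 1
    rw [Finset.sum_eq_single e]
    · simp
    · intro i _ hi
      simp [hi]
    · simp
  have hWherm (i : ι) : (W i).IsHermitian := by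
    refine (hY i).sub ?_
    by_cases hi : i = e
    · subst hi
      simp [Matrix.IsHermitian, Matrix.conjTranspose_smul]
    · simp [hi]
  refine ⟨W, hWherm, fun j => ?_, ?_⟩
  · refine Matrix.IsHermitian.posDef_of_trace_mul_pos ?_ fun k hk hk1 => ?_
    · exact isSelfAdjoint_sum _ fun i _ => IsSelfAdjoint.smul (.all _) (hWherm i)
    · have hmem : Pi.single j k ∈ T := by
        refine ⟨fun j' => ?_, ?_⟩
        · by_cases h : j' = j
          · subst h; simpa using hk
          · simpa [h] using Matrix.PosSemidef.zero
        · rw [Finset.sum_eq_single j]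
          · simpa using hk1
          · intro j' _ h
            simp [h]
          · simp
      have hval (i : ι) : L (Pi.single j k) i = a j i • k := by
        rw [hLapp, Finset.sum_eq_single j]
        · simp
        · intro j' _ h
          simp [h]
        · simp
      have h1 := hfT _ ⟨_, hmem, rfl⟩
      have h2 := hWsum (L (Pi.single j k)) fun i => by
        rw [hval]
        exact IsSelfAdjoint.smul (.all _) hk.1
      simp only [hval, he, one_smul, hk1, mul_one] at h2
      have h3 : ((∑ i, a j i • W i) * k).trace.re = ∑ i, (W i * a j i • k).trace.re := by
        simp [Finset.sum_mul, Matrix.trace_sum]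
      rw [h3, h2]
      linarith
  · rw [hWsum B hB, hBe, map_smul, smul_eq_mul, inv_mul_lt_iff₀ hNpos] at *
    simp only [Matrix.trace_one, Complex.natCast_re]
    linarith

/-- If the inclusion of the maximal free set of `W` into the minimal one of `V`, scaled by `s`,
holds, then so does the inclusion of the maximal free set of `V` into the minimal one of `W`. -/
lemma inclusion_of_polar_inclusion [DecidableEq n] [Nonempty n] {I J ι : Type*} [Fintype I]
    [Fintype J] [Nonempty J] [Fintype ι] (v : I → ι → ℝ) (w : J → ι → ℝ)
    (hw : ∀ i, ∑ j, w j i = 0) (s : ι → ℝ)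
    (h : ∀ Z : ι → Matrix n n ℂ, (∀ i, (Z i).IsHermitian) →
      (∀ j, (1 - ∑ i, w j i • Z i).PosSemidef) →
      ∃ K : I → Matrix n n ℂ, (∀ k, (K k).PosSemidef) ∧ ∑ k, K k = 1 ∧
        ∀ i, s i • Z i = ∑ k, v k i • K k)
    (Z : ι → Matrix n n ℂ) (hZ : ∀ i, (Z i).IsHermitian)
    (hZv : ∀ k, (1 - ∑ i, v k i • Z i).PosSemidef) :
    ∃ K : J → Matrix n n ℂ, (∀ j, (K j).PosSemidef) ∧ ∑ j, K j = 1 ∧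
      ∀ i, s i • Z i = ∑ j, w j i • K j := by
  classical
  by_contra hno
  obtain ⟨Y, hY, hYw, hneg⟩ := exists_dual_certificate
    (fun (j : J) (o : Option ι) => o.elim 1 (w j)) none (fun _ => rfl)
    (fun o : Option ι => o.elim (1 : Matrix n n ℂ) fun i => s i • Z i)
    (by
      rintro (_ | i)
      · exact Matrix.isHermitian_one
      · exact IsSelfAdjoint.smul (.all _) (hZ i))
    rfl
    (by
      rintro ⟨K, hK, hKB⟩
      exact hno ⟨K, hK, by simpa using (hKB none).symm, fun i => by simpa using hKB (some i)⟩)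
  simp only [Fintype.sum_option, Option.elim_none, Option.elim_some, one_smul, mul_one] at hYw hneg
  have hY0 : (Y none).PosDef := by
    have hsum : (∑ j, (Y none + ∑ i, w j i • Y (some i))).PosDef :=
      Matrix.posDef_sum Finset.univ_nonempty fun j _ => hYw j
    rw [Finset.sum_add_distrib, Finset.sum_comm] at hsum
    simp only [← Finset.sum_smul, hw, zero_smul, Finset.sum_const_zero, add_zero,
      Finset.sum_const, Finset.card_univ] at hsum
    have hc : (0 : ℝ) < (Fintype.card J : ℝ)⁻¹ := by simp [Fintype.card_pos]
    have := hsum.smul hc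
    rwa [← Nat.cast_smul_eq_nsmul ℝ, inv_smul_smul₀ (by simp)] at this
  obtain ⟨R, hR⟩ : ∃ R : Matrix n n ℂ, Y none = Rᴴ * R := by
    open scoped MatrixOrder in
    exact CStarAlgebra.nonneg_iff_eq_star_mul_self.mp hY0.posSemidef.nonneg
  have hRu : IsUnit R.det := by
    have := (Matrix.isUnit_iff_isUnit_det _).mp hY0.isUnit
    rw [hR, Matrix.det_mul] at this
    exact isUnit_of_mul_isUnit_right this
  have hRR : R * R⁻¹ = 1 := Matrix.mul_nonsing_inv _ hRu
  have hRR' : R⁻¹ * R = 1 := Matrix.nonsing_inv_mul _ hRu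
  have hRRh : (R⁻¹)ᴴ * Rᴴ = 1 := by rw [← Matrix.conjTranspose_mul, hRR, conjTranspose_one]
  have hRRh' : Rᴴ * (R⁻¹)ᴴ = 1 := by rw [← Matrix.conjTranspose_mul, hRR', conjTranspose_one]
  obtain ⟨K, hK, hK1, hKs⟩ := h (fun i => -((R⁻¹)ᴴ * Y (some i) * R⁻¹))
    (fun i => (Matrix.isHermitian_conjTranspose_mul_mul _ (hY _)).neg)
    (fun j => by
      convert (hYw j).posSemidef.conjTranspose_mul_mul_same R⁻¹ using 1
      rw [hR, mul_add, add_mul, ← mul_assoc, hRRh, one_mul, hRR]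
      simp [Finset.mul_sum, Finset.sum_mul])
  have hYK (i : ι) : s i • Y (some i) = -∑ k, v k i • (Rᴴ * K k * R) := by
    have hconj : Rᴴ * ((R⁻¹)ᴴ * Y (some i) * R⁻¹) * R = Y (some i) := by
      rw [← mul_assoc, ← mul_assoc, hRRh', one_mul, mul_assoc, hRR', mul_one]
    have h1 := congrArg (fun M => Rᴴ * M * R) (hKs i)
    simp only [smul_neg, mul_neg, neg_mul, mul_smul_comm, smul_mul_assoc, hconj,
      Finset.mul_sum, Finset.sum_mul] at h1
    rw [← h1, neg_neg]
  have hterm (i : ι) : (Y (some i) * s i • Z i).trace.re =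
      -∑ k, v k i * (Rᴴ * K k * R * Z i).trace.re := by
    rw [mul_smul_comm, ← smul_mul_assoc, hYK]
    simp [Finset.sum_mul, Matrix.trace_sum]
  have hnonneg : 0 ≤ ∑ k, (Rᴴ * K k * R * (1 - ∑ i, v k i • Z i)).trace.re :=
    Finset.sum_nonneg fun k _ =>
      ((hK k).conjTranspose_mul_mul_same R).trace_mul_re_nonneg (hZv k)
  have hY0sum : (Y none).trace.re = ∑ k, (Rᴴ * K k * R).trace.re := by
    rw [← Complex.re_sum, ← Matrix.trace_sum, ← Finset.sum_mul, ← Finset.mul_sum, hK1, mul_one, hR]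
  have hexpand : ∑ k, (Rᴴ * K k * R * (1 - ∑ i, v k i • Z i)).trace.re =
      (Y none).trace.re + ∑ i, (Y (some i) * s i • Z i).trace.re := by
    simp only [hterm, hY0sum, Finset.sum_neg_distrib]
    rw [Finset.sum_comm, ← sub_eq_add_neg, ← Finset.sum_sub_distrib]
    simp [mul_sub, Finset.mul_sum, Matrix.trace_sum]
  linarith

end MatrixDuality

/-- The origin together with the vertices `± e_i` of the cross-polytope. -/
def axisVector (g : ℕ) : Option (Fin g × Bool) → Fin g → ℝ
  | none, _ => 0
  | some (k, b), i => if k = i then (if b then 1 else -1) else 0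

lemma sum_axisVector_smul {g d : ℕ} (K : Option (Fin g × Bool) → Matrix (Fin d) (Fin d) ℂ)
    (i : Fin g) :
    ∑ o, axisVector g o i • K o = K (some (i, true)) - K (some (i, false)) := by
  simp [axisVector, Fintype.sum_option, Fintype.sum_prod_type, ite_smul,
    sub_eq_add_neg]

lemma isEffect_of_axisVector {g d : ℕ} {Z : Fin g → Matrix (Fin d) (Fin d) ℂ}
    (hZ : ∀ o, (1 - ∑ i, axisVector g o i • Z i).PosSemidef) (i : Fin g) :
    IsEffect ((2 : ℝ)⁻¹ • (1 + Z i)) := by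
  have hsub : (1 - Z i).PosSemidef := by
    simpa [axisVector, ite_smul] using hZ (some (i, true))
  have hadd : (1 + Z i).PosSemidef := by
    simpa [axisVector, ite_smul] using hZ (some (i, false))
  have hhalf : (0 : ℝ) ≤ 2⁻¹ := by norm_num
  refine ⟨hadd.smul hhalf, ?_⟩
  convert hsub.smul hhalf using 1
  module

/-- In terms of `Z i = 2 E i - 1`, compatibility of noisy effects is a decomposition of `s i • Z i`
along the vertices of the cube. -/
lemma compatibleEffects_noisy_iff {g d : ℕ} (s : Fin g → ℝ)
    (Z : Fin g → Matrix (Fin d) (Fin d) ℂ) :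
    CompatibleEffects (fun i => s i • ((2 : ℝ)⁻¹ • (1 + Z i)) +
        ((1 - s i) * (2 : ℝ)⁻¹) • (1 : Matrix (Fin d) (Fin d) ℂ)) ↔
      ∃ K : (Fin g → Bool) → Matrix (Fin d) (Fin d) ℂ, (∀ ε, (K ε).PosSemidef) ∧ ∑ ε, K ε = 1 ∧
        ∀ i, s i • Z i = ∑ ε, (if ε i then (1 : ℝ) else -1) • K ε := by
  refine exists_congr fun K => and_congr_right fun _ => and_congr_right fun hK1 =>
    forall_congr' fun i => ?_
  have hsplit : ∑ ε, (if ε i then (1 : ℝ) else -1) • K ε =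
      (2 : ℝ) • ∑ ε ∈ Finset.univ.filter (fun ε : Fin g → Bool => ε i = true), K ε - 1 := by
    rw [← hK1, Finset.sum_filter, Finset.smul_sum, ← Finset.sum_sub_distrib]
    refine Finset.sum_congr rfl fun ε _ => ?_
    split_ifs <;> module
  rw [hsplit]
  constructor
  · intro h
    rw [← h]
    module
  · intro h
    dsimp only
    rw [smul_add, smul_add, smul_comm (s i) _ (Z i), h]
    module

/-- `Γ(g,d)` equals the matrix diamond inclusion set `Δ_◇(g,d)`. -/
theorem gamma_eq_matrix_diamond_inclusion (g d : ℕ) (hg : 0 < g) (hd : 0 < d)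
    (s : Fin g → ℝ) (hs : ∀ i, s i ∈ Set.Icc (0 : ℝ) 1) :
    s ∈ GammaD g d ↔
      ∀ X : Fin g → Matrix (Fin d) (Fin d) ℂ, (∀ i, (X i).IsHermitian) →
        (∀ ε : Fin g → Bool,
          ((1 : Matrix (Fin d) (Fin d) ℂ) -
            ∑ i, (if ε i then (1 : ℝ) else -1) • X i).PosSemidef) →
        ∃ P N : Fin g → Matrix (Fin d) (Fin d) ℂ,
          (∀ i, (P i).PosSemidef) ∧ (∀ i, (N i).PosSemidef) ∧
          (∀ i, s i • X i = P i - N i) ∧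
          ((1 : Matrix (Fin d) (Fin d) ℂ) - ∑ i, (P i + N i)).PosSemidef := by
  have := Fin.pos_iff_nonempty.mp hd
  have hsign (i : Fin g) : ∑ ε : Fin g → Bool, (if ε i then (1 : ℝ) else -1) = 0 := by
    refine Finset.sum_involution (fun ε _ => Function.update ε i (!ε i)) ?_ ?_ ?_ ?_
    · intro ε _
      cases h : ε i <;> simp
    · intro ε _ _ h
      have := congrFun h i
      simp at this
    · simp
    · intro ε _
      simp
  have haxis (i : Fin g) : ∑ o, axisVector g o i = 0 := by
    simp [axisVector, Fintype.sum_option, Fintype.sum_prod_type]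
  constructor
  · rintro ⟨-, hΓ⟩ X hX hXε
    obtain ⟨K, hK, hK1, hKX⟩ := inclusion_of_polar_inclusion
      (fun (ε : Fin g → Bool) i => if ε i then (1 : ℝ) else -1) (axisVector g) haxis s
      (fun Z _ hZw => (compatibleEffects_noisy_iff s Z).mp
        (hΓ _ fun i => isEffect_of_axisVector hZw i)) X hX hXε
    refine ⟨fun i => K (some (i, true)), fun i => K (some (i, false)), fun i => hK _,
      fun i => hK _, fun i => ?_, ?_⟩
    · rw [hKX, sum_axisVector_smul]
    · rw [← hK1, Fintype.sum_option, Fintype.sum_prod_type]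
      simpa using hK none
  · intro hX
    refine ⟨hs, fun E hE => ?_⟩
    obtain ⟨Z, rfl⟩ : ∃ Z : Fin g → Matrix (Fin d) (Fin d) ℂ,
        E = fun i => (2 : ℝ)⁻¹ • (1 + Z i) :=
      ⟨fun i => (2 : ℝ) • E i - 1, funext fun i => by simp⟩
    have hadd (i : Fin g) : (1 + Z i).PosSemidef := by
      simpa using (hE i).1.smul (zero_le_two (α := ℝ))
    have hsub (i : Fin g) : (1 - Z i).PosSemidef := by
      convert (hE i).2.smul (zero_le_two (α := ℝ)) using 1
      rw [smul_sub, smul_inv_smul₀ two_ne_zero, two_smul]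
      abel
    refine (compatibleEffects_noisy_iff s Z).mpr (inclusion_of_polar_inclusion
      (axisVector g) (fun (ε : Fin g → Bool) i => if ε i then (1 : ℝ) else -1) hsign s ?_ Z
      (fun i => by simpa using (hadd i).1.sub Matrix.isHermitian_one) ?_)
    · intro X hXh hXε
      obtain ⟨P, N, hP, hN, hPN, hsum⟩ := hX X hXh hXε
      refine ⟨fun o => o.elim (1 - ∑ i, (P i + N i)) fun p => if p.2 then P p.1 else N p.1,
        ?_, ?_, fun i => ?_⟩
      · rintro (_ | ⟨i, _ | _⟩)
        · exact hsum
        · exact hN i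
        · exact hP i
      · simp [Fintype.sum_option, Fintype.sum_prod_type]
      · rw [hPN, sum_axisVector_smul]
        simp
    · rintro (_ | ⟨i, _ | _⟩)
      · simpa [axisVector] using Matrix.PosSemidef.one
      · simpa [axisVector, Finset.sum_ite_eq, ite_smul, sub_eq_add_neg] using hadd i
      · simpa [axisVector, ite_smul] using hsub i
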